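/- Let G be a group. Consider the G-set S whose elements are pairs (N, x) where N ranges over all normal subgroups of G of finite index and x ∈ G⧸N, with G acting by left multiplication on the coset component (i.e. S is the disjoint union, over all cofinite normal subgroups N of G, of the orbits G⧸N). Then S is an admissible G-set. -/

import Mathlib

namespace Stmt9

/-- A `G`-set `S` is *admissible* if the stabilizer of every point has finite index in `G`
and, for every finite-index subgroup `H ≤ G`, the `H`-fixed point set of `S` is finite. -/
def IsAdmissible (G : Type*) [Group G] (S : Type*) [MulAction G S] : Prop :=
  (∀ s : S, (MulAction.stabilizer G s).FiniteIndex) ∧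
    ∀ H : Subgroup G, H.FiniteIndex → {s : S | ∀ h ∈ H, h • s = s}.Finite

/-- The disjoint union, over all cofinite (i.e. finite-index) normal subgroups `N` of `G`,
of the orbits `G ⧸ N`. -/
def NormalOrbits (G : Type*) [Group G] : Type _ :=
  (N : {N : Subgroup G // N.Normal ∧ N.FiniteIndex}) × (G ⧸ N.val)

/-- `G` acts on the disjoint union by left multiplication on each coset component. -/
instance (G : Type*) [Group G] : MulAction G (NormalOrbits G) where
  smul g x := ⟨x.1, g • x.2⟩
  one_smul x := by
    cases x with
    | mk N y => exact congrArg (Sigma.mk N) (one_smul G y)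
  mul_smul g g' x := by
    cases x with
    | mk N y => exact congrArg (Sigma.mk N) (mul_smul g g' y)

theorem finite_setOf_le_of_finiteIndex {G : Type*} [Group G] (H : Subgroup G)
    [H.FiniteIndex] : {K : Subgroup G | H ≤ K}.Finite := by
  refine Set.Finite.of_finite_image
    (f := fun K : Subgroup G => ((↑) : G → G ⧸ H) '' (K : Set G)) (Set.toFinite _) ?_
  have le_of_image_eq {K L : Subgroup G} (hL : H ≤ L)
      (hKL : ((↑) : G → G ⧸ H) '' (K : Set G) = ((↑) : G → G ⧸ H) '' (L : Set G)) : K ≤ L := by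
    intro g hg
    obtain ⟨l, hl, hlg⟩ := hKL ▸ Set.mem_image_of_mem ((↑) : G → G ⧸ H) hg
    exact (L.mul_mem_cancel_left (L.inv_mem hl)).mp (hL (QuotientGroup.eq.mp hlg))
  intro K hK L hL hKL
  exact le_antisymm (le_of_image_eq hL hKL) (le_of_image_eq hK hKL.symm)

theorem NormalOrbits.smul_eq_self_iff {G : Type*} [Group G] (g : G) (s : NormalOrbits G) :
    g • s = s ↔ g ∈ s.1.val := by
  obtain ⟨N, x⟩ := s
  induction x using QuotientGroup.induction_on with | H a => ?_
  change Sigma.mk (β := fun N : {N : Subgroup G // N.Normal ∧ N.FiniteIndex} => G ⧸ N.val) N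
    ((g * a : G) : G ⧸ N.val) = ⟨N, (a : G ⧸ N.val)⟩ ↔ g ∈ N.val
  refine (sigma_mk_injective (i := N)).eq_iff.trans ?_
  rw [eq_comm, QuotientGroup.eq, ← mul_assoc]
  simpa using N.2.1.mem_comm_iff (a := a⁻¹ * g) (b := a)

/-- The disjoint union of the orbits `G ⧸ N` over all cofinite normal subgroups `N ≤ G`
is an admissible `G`-set. -/
theorem normalOrbits_isAdmissible (G : Type*) [Group G] :
    IsAdmissible G (NormalOrbits G) := by
  constructor
  · intro s
    have h : MulAction.stabilizer G s = s.1.val :=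
      Subgroup.ext fun g => NormalOrbits.smul_eq_self_iff g s
    exact h ▸ s.1.2.2
  · intro H hH
    have hfin : {N : {N : Subgroup G // N.Normal ∧ N.FiniteIndex} | H ≤ N.val}.Finite :=
      (finite_setOf_le_of_finiteIndex H).preimage Subtype.val_injective.injOn
    refine (hfin.biUnion (t := fun N => Set.range fun x : G ⧸ N.val => (⟨N, x⟩ : NormalOrbits G))
      fun N _ => ?_).subset ?_
    · have := N.2.2
      exact Set.finite_range _
    · intro s hs
      exact Set.mem_biUnion (x := s.1)
        (fun g hg => (NormalOrbits.smul_eq_self_iff g s).mp (hs g hg)) ⟨s.2, rfl⟩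

end Stmt9
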